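/- Suppose the G₁-Assumption holds for m = k + pk, and let X = Q ρ(Λ)^q Qᵀ X₀ for X₀ ∈ ℝ^{n×k}, integer q ≥ 1, and ρ: ℝ → ℝ satisfying the ordering condition min_{1≤j≤k}|ρ(λ_j)| = |ρ(λ_k)| ≥ |ρ(λ_{k+1})| ≥ ⋯ ≥ |ρ(λ_{k+1+pk})| = max_{k+pk<j≤n}|ρ(λ_j)| with |ρ(λ_{k+1})| > 0, together with min_{i≤k} ‖q_iᵀX₀‖₂ > 0, min_{j>k} ‖q_jᵀX₀‖₂ > 0, and min_{i≤k} ‖e_iᵀV‖₂ > 0. Then there exist constants C_p and C′_p (explicitly, C_p = Γ_{k,k+pk}(QᵀX₀)·Γ_{k,k+pk}(V)·‖G₁†E_k‖₂ and C′_p = ((max_{j>k+pk}‖q_jᵀX₀‖₂)/(min_{j>k}‖q_jᵀX₀‖₂))·Γ_{k,k+pk}(V)·‖G₁†E_k‖₂) such that δ_k(Y) ≤ C_p |ρ(λ_{k+1+pk})/ρ(λ_k)|^q and δ_k(Y) ≤ C′_p |ρ(λ_{k+1+pk})/ρ(λ_{k+1})|^q · δ_k(X). -/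

import Mathlib

open Matrix

namespace ARR

/-- Euclidean norm of the `i`-th row of a matrix. -/
noncomputable def rowNorm {R C : Type*} [Fintype C] (M : Matrix R C ℝ) (i : R) : ℝ :=
  Real.sqrt (∑ j, M i j ^ 2)

/-- Supremum of `f` over indices satisfying `P`. -/
noncomputable def supOver {n : ℕ} (P : Fin n → Prop) (f : Fin n → ℝ) : ℝ :=
  sSup (f '' {i | P i})

/-- Infimum of `f` over indices satisfying `P`. -/
noncomputable def infOver {n : ℕ} (P : Fin n → Prop) (f : Fin n → ℝ) : ℝ :=
  sInf (f '' {i | P i})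

/-- The accuracy measure `δₖ(Z) = max_{i>k} ‖qᵢᵀZ‖ / min_{i≤k} ‖qᵢᵀZ‖`
(indices are 1-based in the paper; here `i > k` means `k ≤ i` for 0-based `i`). -/
noncomputable def deltaK {n k : ℕ} (Q : Matrix (Fin n) (Fin n) ℝ)
    (Z : Matrix (Fin n) (Fin k) ℝ) : ℝ :=
  supOver (fun i => k ≤ (i : ℕ)) (rowNorm (Qᵀ * Z)) /
    infOver (fun i => (i : ℕ) < k) (rowNorm (Qᵀ * Z))

/-- `Γ_{k,m}(M) = max_{i>m} ‖eᵢᵀM‖ / min_{i≤k} ‖eᵢᵀM‖`. -/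
noncomputable def gammaKM {n : ℕ} {C : Type*} [Fintype C] (k m : ℕ)
    (M : Matrix (Fin n) C ℝ) : ℝ :=
  supOver (fun i => m ≤ (i : ℕ)) (rowNorm M) / infOver (fun i => (i : ℕ) < k) (rowNorm M)

/-- Spectral (operator 2-) norm of a matrix. -/
noncomputable def specNorm {a b : Type*} [Fintype a] [Fintype b] [DecidableEq b]
    (M : Matrix a b ℝ) : ℝ :=
  ‖LinearMap.toContinuousLinearMap (Matrix.toEuclideanLin M)‖

/-- The Vandermonde matrix `V` with `V i j = λᵢ^j`, `0 ≤ j ≤ p`. -/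
def vand {n : ℕ} (lam : Fin n → ℝ) (p : ℕ) : Matrix (Fin n) (Fin (p + 1)) ℝ :=
  fun i j => lam i ^ (j : ℕ)

/-- The diagonal of `D`: `Dᵢᵢ = ‖qᵢᵀX‖₂ ⬝ ‖eᵢᵀV‖₂` (the norm of the `i`-th row of `Ĝ`). -/
noncomputable def dvec {n k : ℕ} (lam : Fin n → ℝ) (p : ℕ) (Q : Matrix (Fin n) (Fin n) ℝ)
    (X : Matrix (Fin n) (Fin k) ℝ) : Fin n → ℝ :=
  fun i => rowNorm (Qᵀ * X) i * rowNorm (vand lam p) i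

/-- `G = D† Ĝ`, where `Ĝ = [QᵀX, ΛQᵀX, …, ΛᵖQᵀX]`; the column block index is `j.1`. -/
noncomputable def gmat {n k : ℕ} (lam : Fin n → ℝ) (p : ℕ) (Q : Matrix (Fin n) (Fin n) ℝ)
    (X : Matrix (Fin n) (Fin k) ℝ) : Matrix (Fin n) (Fin (p + 1) × Fin k) ℝ :=
  fun i j => (dvec lam p Q X i)⁻¹ * (lam i ^ (j.1 : ℕ) * (Qᵀ * X) i j.2)

/-- The augmented matrix `X_p = [X, AX, …, AᵖX]`; the column block index is `j.1`. -/
noncomputable def aug {n k : ℕ} (A : Matrix (Fin n) (Fin n) ℝ)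
    (X : Matrix (Fin n) (Fin k) ℝ) (p : ℕ) : Matrix (Fin n) (Fin (p + 1) × Fin k) ℝ :=
  fun i j => (A ^ (j.1 : ℕ) * X) i j.2

/-- First `m` rows of a matrix. -/
def topRows {n : ℕ} {C : Type*} (m : ℕ) (hmn : m ≤ n) (M : Matrix (Fin n) C ℝ) :
    Matrix (Fin m) C ℝ :=
  fun i j => M (Fin.castLE hmn i) j

/-- Last `n - m` rows of a matrix. -/
def lowRows {n : ℕ} {C : Type*} (m : ℕ) (hmn : m ≤ n) (M : Matrix (Fin n) C ℝ) :
    Matrix (Fin (n - m)) C ℝ :=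
  fun i j => M ⟨m + (i : ℕ), by have := i.isLt; omega⟩ j

/-- First `m` columns of a square matrix (`Q_m`). -/
def colsTop {n : ℕ} (m : ℕ) (hmn : m ≤ n) (M : Matrix (Fin n) (Fin n) ℝ) :
    Matrix (Fin n) (Fin m) ℝ :=
  fun i j => M i (Fin.castLE hmn j)

/-- Last `n - m` columns of a square matrix (`Q_{m+}`). -/
def colsLow {n : ℕ} (m : ℕ) (hmn : m ≤ n) (M : Matrix (Fin n) (Fin n) ℝ) :
    Matrix (Fin n) (Fin (n - m)) ℝ :=
  fun i j => M i ⟨m + (j : ℕ), by have := j.isLt; omega⟩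

/-- `E_k`: the first `k` columns of the `m × m` identity matrix. -/
def ekMat (m k : ℕ) : Matrix (Fin m) (Fin k) ℝ :=
  fun i j => if (i : ℕ) = (j : ℕ) then 1 else 0

/-- `D₁⁻¹`: the inverse of the leading `m × m` block of `D`. -/
noncomputable def d1inv {n : ℕ} (m : ℕ) (hmn : m ≤ n) (d : Fin n → ℝ) :
    Matrix (Fin m) (Fin m) ℝ :=
  Matrix.diagonal fun i => (d (Fin.castLE hmn i))⁻¹

/-- `D₂`: the trailing `(n-m) × (n-m)` block of `D`. -/
noncomputable def d2mat {n : ℕ} (m : ℕ) (hmn : m ≤ n) (d : Fin n → ℝ) :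
    Matrix (Fin (n - m)) (Fin (n - m)) ℝ :=
  Matrix.diagonal fun i => d ⟨m + (i : ℕ), by have := i.isLt; omega⟩

/-- `Y = X_p G₁† D₁⁻¹ E_k`, where `A = Q Λ Qᵀ` and `X_p = [X, AX, …, AᵖX]`. -/
noncomputable def ymat {n k : ℕ} (m : ℕ) (hmn : m ≤ n) (lam : Fin n → ℝ) (p : ℕ)
    (Q : Matrix (Fin n) (Fin n) ℝ) (X : Matrix (Fin n) (Fin k) ℝ)
    (Gpinv : Matrix (Fin (p + 1) × Fin k) (Fin m) ℝ) : Matrix (Fin n) (Fin k) ℝ :=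
  aug (Q * Matrix.diagonal lam * Qᵀ) X p * Gpinv * d1inv m hmn (dvec lam p Q X) * ekMat m k

end ARR

namespace ARR

section RowNorm

variable {R R' C C' : Type*} [Fintype C] [Fintype C']

lemma rowNorm_nonneg (M : Matrix R C ℝ) (i : R) : 0 ≤ rowNorm M i := Real.sqrt_nonneg _

lemma rowNorm_eq_norm (M : Matrix R C ℝ) (i : R) : rowNorm M i = ‖WithLp.toLp 2 (M i)‖ := by
  simp [rowNorm, EuclideanSpace.norm_eq]

lemma rowNorm_le_mul {M : Matrix R C ℝ} {N : Matrix R' C ℝ} {i : R} {i' : R'} {c : ℝ}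
    (hc : 0 ≤ c) (h : ∀ j, |M i j| ≤ c * |N i' j|) : rowNorm M i ≤ c * rowNorm N i' := by
  rw [rowNorm, rowNorm, ← Real.sqrt_sq hc, ← Real.sqrt_mul (sq_nonneg c), Finset.mul_sum]
  refine Real.sqrt_le_sqrt (Finset.sum_le_sum fun j _ => ?_)
  rw [← sq_abs (M i j), ← sq_abs (N i' j), ← mul_pow]
  exact pow_le_pow_left₀ (abs_nonneg _) (h j) 2

lemma rowNorm_eq_abs_mul {M : Matrix R C ℝ} {N : Matrix R' C ℝ} {i : R} {i' : R'} {c : ℝ}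
    (h : ∀ j, M i j = c * N i' j) : rowNorm M i = |c| * rowNorm N i' := by
  rw [rowNorm, rowNorm, ← Real.sqrt_sq (abs_nonneg c), ← Real.sqrt_mul (sq_nonneg _),
    Finset.mul_sum]
  simp [h, mul_pow]

lemma abs_le_rowNorm (M : Matrix R C ℝ) (i : R) (j : C) : |M i j| ≤ rowNorm M i := by
  rw [← Real.sqrt_sq_eq_abs]
  exact Real.sqrt_le_sqrt
    (Finset.single_le_sum (f := fun j => M i j ^ 2) (fun _ _ => sq_nonneg _) (Finset.mem_univ j))

open scoped Matrix.Norms.L2Operator in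
lemma rowNorm_mul_le [DecidableEq C] [DecidableEq C'] (N : Matrix R C ℝ) (M : Matrix C C' ℝ)
    (i : R) : rowNorm (N * M) i ≤ rowNorm N i * specNorm M := by
  have h := Matrix.l2_opNorm_mulVec Mᴴ (WithLp.toLp 2 (N i))
  rw [Matrix.l2_opNorm_conjTranspose, Matrix.l2_opNorm_def] at h
  rw [rowNorm_eq_norm, rowNorm_eq_norm, mul_comm]
  have e : (N * M) i = Mᴴ *ᵥ N i := by
    ext j
    simp [Matrix.mul_apply, Matrix.mulVec, dotProduct, mul_comm]
  rw [e]
  exact h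

end RowNorm

section Extrema

variable {n : ℕ} {P : Fin n → Prop} {f : Fin n → ℝ}

lemma le_supOver {i : Fin n} (hi : P i) : f i ≤ supOver P f :=
  le_csSup (Set.toFinite _).bddAbove ⟨i, hi, rfl⟩

lemma infOver_le {i : Fin n} (hi : P i) : infOver P f ≤ f i :=
  csInf_le (Set.toFinite _).bddBelow ⟨i, hi, rfl⟩

lemma supOver_le {a : ℝ} (hP : ∃ i, P i) (h : ∀ i, P i → f i ≤ a) : supOver P f ≤ a :=
  csSup_le (Set.Nonempty.image f hP) (by rintro _ ⟨i, hi, rfl⟩; exact h i hi)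

lemma le_infOver {a : ℝ} (hP : ∃ i, P i) (h : ∀ i, P i → a ≤ f i) : a ≤ infOver P f :=
  le_csInf (Set.Nonempty.image f hP) (by rintro _ ⟨i, hi, rfl⟩; exact h i hi)

end Extrema

lemma rowNorm_vand_pos {n : ℕ} (lam : Fin n → ℝ) (p : ℕ) (i : Fin n) :
    0 < rowNorm (vand lam p) i :=
  lt_of_lt_of_le (by simp [vand]) (abs_le_rowNorm (vand lam p) i 0)

section Augmented

variable {n k p : ℕ} (lam : Fin n → ℝ) {Q : Matrix (Fin n) (Fin n) ℝ}
  (X : Matrix (Fin n) (Fin k) ℝ)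

lemma dvec_nonneg (Q : Matrix (Fin n) (Fin n) ℝ) (i : Fin n) : 0 ≤ dvec lam p Q X i :=
  mul_nonneg (rowNorm_nonneg _ _) (rowNorm_nonneg _ _)

lemma rowNorm_gmat_le_one (Q : Matrix (Fin n) (Fin n) ℝ) (i : Fin n) :
    rowNorm (gmat lam p Q X) i ≤ 1 := by
  let Ghat : Matrix (Fin n) (Fin (p + 1) × Fin k) ℝ := fun i j =>
    lam i ^ (j.1 : ℕ) * (Qᵀ * X) i j.2
  have h : rowNorm Ghat i = dvec lam p Q X i := by
    rw [rowNorm, dvec, rowNorm, rowNorm, ← Real.sqrt_mul (Finset.sum_nonneg fun _ _ => sq_nonneg _),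
      mul_comm, Finset.sum_mul_sum, Fintype.sum_prod_type]
    simp only [Ghat, vand, mul_pow]
  rw [rowNorm_eq_abs_mul (M := gmat lam p Q X) (N := Ghat) (i' := i)
    (c := (dvec lam p Q X i)⁻¹) (fun _ => rfl), h,
    abs_of_nonneg (inv_nonneg.2 (dvec_nonneg lam X Q i))]
  exact inv_mul_le_one

lemma transpose_mul_aug (hQ' : Qᵀ * Q = 1) (i : Fin n) (j : Fin (p + 1) × Fin k) :
    (Qᵀ * aug (Q * Matrix.diagonal lam * Qᵀ) X p) i j = dvec lam p Q X i * gmat lam p Q X i j := by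
  have hpow : ∀ a : ℕ, Qᵀ * (Q * Matrix.diagonal lam * Qᵀ) ^ a = Matrix.diagonal lam ^ a * Qᵀ := by
    intro a
    induction a with
    | zero => simp
    | succ a ih =>
      rw [pow_succ, ← Matrix.mul_assoc, ih, pow_succ]
      simp only [Matrix.mul_assoc]
      rw [← Matrix.mul_assoc Qᵀ Q, hQ', Matrix.one_mul]
  have h : (Qᵀ * aug (Q * Matrix.diagonal lam * Qᵀ) X p) i j =
      lam i ^ (j.1 : ℕ) * (Qᵀ * X) i j.2 := by
    change (Qᵀ * ((Q * Matrix.diagonal lam * Qᵀ) ^ (j.1 : ℕ) * X)) i j.2 = _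
    rw [← Matrix.mul_assoc, hpow, Matrix.mul_assoc, Matrix.diagonal_pow, Matrix.diagonal_mul]
    simp
  rw [h, gmat]
  by_cases hd : dvec lam p Q X i = 0
  · have hW : rowNorm (Qᵀ * X) i = 0 :=
      (mul_eq_zero.1 hd).resolve_right (rowNorm_vand_pos lam p i).ne'
    have : (Qᵀ * X) i j.2 = 0 := abs_nonpos_iff.1 (hW ▸ abs_le_rowNorm (Qᵀ * X) i j.2)
    simp [this]
  · rw [mul_inv_cancel_left₀ hd]

variable {m : ℕ} (hmn : m ≤ n) {Gpinv : Matrix (Fin (p + 1) × Fin k) (Fin m) ℝ}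

lemma dvec_ne_zero (hG1 : topRows m hmn (gmat lam p Q X) * Gpinv = 1) (i : Fin m) :
    dvec lam p Q X (Fin.castLE hmn i) ≠ 0 := by
  intro hd
  have h := congrFun (congrFun hG1 i) i
  simp [Matrix.mul_apply, topRows, gmat, hd] at h

lemma transpose_mul_ymat (hkm : k ≤ m) (hQ' : Qᵀ * Q = 1) (i : Fin n) (j : Fin k) :
    (Qᵀ * ymat m hmn lam p Q X Gpinv) i j =
      dvec lam p Q X i * ((gmat lam p Q X * (Gpinv * ekMat m k)) i j *
        (dvec lam p Q X (Fin.castLE (hkm.trans hmn) j))⁻¹) := by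
  have hE : d1inv m hmn (dvec lam p Q X) * ekMat m k = ekMat m k *
      Matrix.diagonal fun j => (dvec lam p Q X (Fin.castLE (hkm.trans hmn) j))⁻¹ := by
    ext a b
    rw [d1inv, Matrix.diagonal_mul, Matrix.mul_diagonal]
    by_cases hab : (a : ℕ) = b
    · have : Fin.castLE hmn a = Fin.castLE (hkm.trans hmn) b := Fin.ext hab
      rw [this, mul_comm]
    · simp [ekMat, hab]
  have hA : Qᵀ * aug (Q * Matrix.diagonal lam * Qᵀ) X p =
      Matrix.diagonal (dvec lam p Q X) * gmat lam p Q X := by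
    ext a b
    rw [transpose_mul_aug lam X hQ', Matrix.diagonal_mul]
  have hY : Qᵀ * ymat m hmn lam p Q X Gpinv = Matrix.diagonal (dvec lam p Q X) *
      ((gmat lam p Q X * (Gpinv * ekMat m k)) *
        Matrix.diagonal fun j => (dvec lam p Q X (Fin.castLE (hkm.trans hmn) j))⁻¹) := by
    rw [ymat, Matrix.mul_assoc _ (d1inv m hmn _), hE, Matrix.mul_assoc (aug _ X p),
      ← Matrix.mul_assoc Qᵀ, hA]
    simp only [Matrix.mul_assoc]
  rw [hY, Matrix.diagonal_mul, Matrix.mul_diagonal]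

lemma transpose_mul_ymat_top (hkm : k ≤ m) (hQ' : Qᵀ * Q = 1)
    (hG1 : topRows m hmn (gmat lam p Q X) * Gpinv = 1) (i : Fin m) (j : Fin k) :
    (Qᵀ * ymat m hmn lam p Q X Gpinv) (Fin.castLE hmn i) j = ekMat m k i j := by
  have h : (gmat lam p Q X * (Gpinv * ekMat m k)) (Fin.castLE hmn i) j = ekMat m k i j := by
    change (topRows m hmn (gmat lam p Q X) * (Gpinv * ekMat m k)) i j = _
    rw [← Matrix.mul_assoc, hG1, Matrix.one_mul]
  rw [transpose_mul_ymat lam X hmn hkm hQ', h]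
  by_cases hij : (i : ℕ) = j
  · have e : Fin.castLE (hkm.trans hmn) j = Fin.castLE hmn i := Fin.ext hij.symm
    rw [e, mul_left_comm, mul_inv_cancel₀ (dvec_ne_zero lam X hmn hG1 i), mul_one]
  · simp [ekMat, hij]

lemma deltaK_ymat_le (hk : 0 < k) (hkm : k ≤ m) (hmn' : m < n) (hQ' : Qᵀ * Q = 1)
    (hG1 : topRows m hmn (gmat lam p Q X) * Gpinv = 1) {a b : ℝ} (hb : 0 < b)
    (hlow : ∀ i : Fin n, (i : ℕ) < k → b ≤ dvec lam p Q X i)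
    (hhigh : ∀ i : Fin n, m ≤ (i : ℕ) → dvec lam p Q X i ≤ a) :
    deltaK Q (ymat m hmn lam p Q X Gpinv) ≤ a / b * specNorm (Gpinv * ekMat m k) := by
  have ha : 0 ≤ a := (dvec_nonneg lam X Q ⟨m, hmn'⟩).trans (hhigh _ le_rfl)
  have hs : 0 ≤ specNorm (Gpinv * ekMat m k) := norm_nonneg _
  have hB : 0 ≤ a / b * specNorm (Gpinv * ekMat m k) := by positivity
  have hinf : 1 ≤ infOver (fun i => (i : ℕ) < k)
      (rowNorm (Qᵀ * ymat m hmn lam p Q X Gpinv)) := by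
    refine le_infOver ⟨⟨0, by omega⟩, hk⟩ fun i hi => ?_
    have h := transpose_mul_ymat_top lam X hmn hkm hQ' hG1 ⟨i, hi.trans_le hkm⟩ ⟨i, hi⟩
    refine le_trans ?_ (abs_le_rowNorm _ i ⟨i, hi⟩)
    have h' : (Qᵀ * ymat m hmn lam p Q X Gpinv) i ⟨i, hi⟩ = 1 := by
      simpa [ekMat] using h
    simp [h']
  refine div_le_of_le_mul₀ (zero_le_one.trans hinf) hB
    (le_trans ?_ (le_mul_of_one_le_right hB hinf))
  refine supOver_le ⟨⟨m, hmn'⟩, hkm⟩ fun i hi => ?_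
  rcases lt_or_ge (i : ℕ) m with him | him
  · have h0 : rowNorm (Qᵀ * ymat m hmn lam p Q X Gpinv) i = 0 := by
      have h : ∀ j, (Qᵀ * ymat m hmn lam p Q X Gpinv) i j = 0 := fun j =>
        (transpose_mul_ymat_top lam X hmn hkm hQ' hG1 ⟨i, him⟩ j).trans
          (if_neg (by have := j.isLt; simp only; omega))
      simp [rowNorm, h]
    rw [h0]
    exact hB
  · calc rowNorm (Qᵀ * ymat m hmn lam p Q X Gpinv) i
        ≤ a / b * rowNorm (gmat lam p Q X * (Gpinv * ekMat m k)) i := by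
          refine rowNorm_le_mul (by positivity) fun j => ?_
          have hj := hlow (Fin.castLE (hkm.trans hmn) j) j.isLt
          rw [transpose_mul_ymat lam X hmn hkm hQ', abs_mul, abs_mul, abs_inv,
            abs_of_nonneg (dvec_nonneg lam X Q i), abs_of_nonneg (hb.le.trans hj), mul_left_comm,
            mul_comm, ← div_eq_mul_inv]
          gcongr
          exact hhigh i him
      _ ≤ a / b * (rowNorm (gmat lam p Q X) i * specNorm (Gpinv * ekMat m k)) := by
          gcongr
          exact rowNorm_mul_le _ _ _
      _ ≤ a / b * specNorm (Gpinv * ekMat m k) := by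
          gcongr
          exact mul_le_of_le_one_left hs (rowNorm_gmat_le_one lam X Q i)

end Augmented

lemma rowNorm_transpose_mul_filtered {n k : ℕ} {Q : Matrix (Fin n) (Fin n) ℝ} (hQ' : Qᵀ * Q = 1)
    (r : Fin n → ℝ) (q : ℕ) (X₀ : Matrix (Fin n) (Fin k) ℝ) (i : Fin n) :
    rowNorm (Qᵀ * (Q * Matrix.diagonal r ^ q * Qᵀ * X₀)) i =
      |r i| ^ q * rowNorm (Qᵀ * X₀) i := by
  rw [← abs_pow]
  refine rowNorm_eq_abs_mul fun j => ?_
  simp only [Matrix.mul_assoc]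
  rw [← Matrix.mul_assoc Qᵀ Q, hQ', Matrix.one_mul, Matrix.diagonal_pow, Matrix.diagonal_mul]
  rfl

end ARR

open ARR in
/-- Corollary 3.1. With `m = k + pk`, `X = ρ(A)^q X₀`, under the ordering
condition on `|ρ(λⱼ)|` with `|ρ(λ_{k+1})| > 0` and the `G₁`-Assumption, both
`δₖ(Y) ≤ C_p |ρ(λ_{k+1+pk})/ρ(λ_k)|^q` and
`δₖ(Y) ≤ C'_p |ρ(λ_{k+1+pk})/ρ(λ_{k+1})|^q δₖ(X)` hold, with the explicit constants
`C_p, C'_p`. (0-based indices: `λ_k = lam ⟨k-1⟩`, `λ_{k+1} = lam ⟨k⟩`,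
`λ_{k+1+pk} = lam ⟨k+p*k⟩`.) -/
theorem arr_corollary {n k p q : ℕ} (hq : 1 ≤ q) (hk : 0 < k) (hn : (p + 1) * k < n)
    (hm : k + p * k < n)
    (lam : Fin n → ℝ) (hlam : Antitone lam)
    (Q : Matrix (Fin n) (Fin n) ℝ) (hQ : Q * Qᵀ = 1) (hQ' : Qᵀ * Q = 1)
    (ρ : ℝ → ℝ) (X₀ X : Matrix (Fin n) (Fin k) ℝ)
    (hX : X = Q * (Matrix.diagonal fun i => ρ (lam i)) ^ q * Qᵀ * X₀)
    (hordmin : ∀ j : Fin n, (j : ℕ) < k → |ρ (lam ⟨k - 1, by omega⟩)| ≤ |ρ (lam j)|)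
    (horddec : ∀ i j : Fin n, k - 1 ≤ (i : ℕ) → (i : ℕ) ≤ (j : ℕ) → (j : ℕ) ≤ k + p * k →
      |ρ (lam j)| ≤ |ρ (lam i)|)
    (hordmax : ∀ j : Fin n, k + p * k ≤ (j : ℕ) → |ρ (lam j)| ≤ |ρ (lam ⟨k + p * k, hm⟩)|)
    (hρk1 : ρ (lam ⟨k, by omega⟩) ≠ 0)
    (hX₀ : 0 < infOver (fun i => (i : ℕ) < k) (rowNorm (Qᵀ * X₀)))
    (hX₀' : 0 < infOver (fun j => k ≤ (j : ℕ)) (rowNorm (Qᵀ * X₀)))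
    (hV : 0 < infOver (fun i => (i : ℕ) < k) (rowNorm (vand lam p)))
    (Gpinv : Matrix (Fin (p + 1) × Fin k) (Fin (k + p * k)) ℝ)
    (hG1 : topRows (k + p * k) hm.le (gmat lam p Q X) * Gpinv = 1) :
    deltaK Q (ymat (k + p * k) hm.le lam p Q X Gpinv) ≤
        (gammaKM k (k + p * k) (Qᵀ * X₀) * gammaKM k (k + p * k) (vand lam p) *
            specNorm (Gpinv * ekMat (k + p * k) k)) *
          |ρ (lam ⟨k + p * k, hm⟩) / ρ (lam ⟨k - 1, by omega⟩)| ^ q ∧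
      deltaK Q (ymat (k + p * k) hm.le lam p Q X Gpinv) ≤
        ((supOver (fun j => k + p * k ≤ (j : ℕ)) (rowNorm (Qᵀ * X₀)) /
              infOver (fun j => k ≤ (j : ℕ)) (rowNorm (Qᵀ * X₀))) *
            gammaKM k (k + p * k) (vand lam p) * specNorm (Gpinv * ekMat (k + p * k) k)) *
          |ρ (lam ⟨k + p * k, hm⟩) / ρ (lam ⟨k, by omega⟩)| ^ q * deltaK Q X := by
  have hkm : k ≤ k + p * k := Nat.le_add_right _ _
  have hw : ∀ i, rowNorm (Qᵀ * X) i = |ρ (lam i)| ^ q * rowNorm (Qᵀ * X₀) i := fun i => by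
    rw [hX, rowNorm_transpose_mul_filtered hQ' (fun i => ρ (lam i))]
  set x := infOver (fun i => (i : ℕ) < k) (rowNorm (Qᵀ * X₀))
  set x' := infOver (fun j => k ≤ (j : ℕ)) (rowNorm (Qᵀ * X₀))
  set v := infOver (fun i => (i : ℕ) < k) (rowNorm (vand lam p)) with hv
  set sx := supOver (fun j => k + p * k ≤ (j : ℕ)) (rowNorm (Qᵀ * X₀)) with hsx
  set sv := supOver (fun j => k + p * k ≤ (j : ℕ)) (rowNorm (vand lam p)) with hsv
  set rm := |ρ (lam ⟨k + p * k, hm⟩)|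
  set r0 := |ρ (lam ⟨k - 1, by omega⟩)|
  set r1 := |ρ (lam ⟨k, by omega⟩)|
  have hr1 : 0 < r1 := abs_pos.2 hρk1
  have hr0 : 0 < r0 :=
    hr1.trans_le (horddec ⟨k - 1, by omega⟩ ⟨k, by omega⟩ le_rfl (Nat.sub_le _ _) hkm)
  have hsx0 : 0 ≤ sx := (rowNorm_nonneg _ _).trans (le_supOver (i := ⟨k + p * k, hm⟩) le_rfl)
  have hsv0 : 0 ≤ sv := (rowNorm_nonneg _ _).trans (le_supOver (i := ⟨k + p * k, hm⟩) le_rfl)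
  have hrm : 0 ≤ rm := abs_nonneg _
  have hhigh : ∀ i : Fin n, k + p * k ≤ (i : ℕ) → dvec lam p Q X i ≤ rm ^ q * sx * sv := fun i hi => by
    rw [dvec, hw]
    have h1 := rowNorm_nonneg (Qᵀ * X₀) i
    have h2 := rowNorm_nonneg (vand lam p) i
    gcongr
    · exact hordmax i hi
    · exact le_supOver hi
    · exact le_supOver hi
  have hwlow : ∀ i : Fin n, (i : ℕ) < k → r0 ^ q * x ≤ rowNorm (Qᵀ * X) i := fun i hi => by
    rw [hw]
    gcongr
    · exact hordmin i hi
    · exact infOver_le hi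
  set w := infOver (fun i => (i : ℕ) < k) (rowNorm (Qᵀ * X)) with hw_def
  have hw0 : r0 ^ q * x ≤ w := le_infOver ⟨⟨0, by omega⟩, hk⟩ hwlow
  have hwpos : 0 < w := lt_of_lt_of_le (by positivity) hw0
  have hlow : ∀ i : Fin n, (i : ℕ) < k → w * v ≤ dvec lam p Q X i := fun i hi =>
    mul_le_mul (infOver_le hi) (infOver_le hi) hV.le (rowNorm_nonneg _ _)
  have key := deltaK_ymat_le lam X hm.le hk hkm hm hQ' hG1 (mul_pos hwpos hV) hlow hhigh
  set s := specNorm (Gpinv * ekMat (k + p * k) k)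
  have hs : 0 ≤ s := norm_nonneg _
  constructor
  · refine key.trans ?_
    rw [gammaKM, gammaKM, ← hsx, ← hsv, ← hv, abs_div]
    calc rm ^ q * sx * sv / (w * v) * s ≤ rm ^ q * sx * sv / (r0 ^ q * x * v) * s := by gcongr
      _ = sx / x * (sv / v) * s * (rm / r0) ^ q := by
        rw [div_pow]
        ring
  · refine key.trans ?_
    have hsw : r1 ^ q * x' ≤ supOver (fun i => k ≤ (i : ℕ)) (rowNorm (Qᵀ * X)) := by
      refine le_trans ?_ (le_supOver (i := ⟨k, by omega⟩) le_rfl)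
      rw [hw]
      gcongr
      exact infOver_le le_rfl
    rw [gammaKM, deltaK, ← hsv, ← hv, ← hw_def, abs_div]
    calc rm ^ q * sx * sv / (w * v) * s
        = sx / x' * (sv / v) * s * (rm / r1) ^ q * (r1 ^ q * x' / w) := by
          rw [div_pow]
          field_simp
      _ ≤ _ := by gcongr
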